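/- For every m >= 2, every j >= 1, and every 1 <= n <= 2^{m-2}, setting z := d_{m-2}^(n) / d_{m-2}^(n+1), the ratio of the j-th descendant odd interval to its parent even interval is I_{m+j}^(2^j(2n-1)+1) / I_m^(2n) = ((2j+3)/3) * (1+2z)(2+z) / (((j+1) + (j+2)z) * ((j+2) + (j+1)z)). -/

import Mathlib

/-- Numerators of the modified Farey sequence: at level `k`, order `n` (1-indexed,
`n = 1, …, 2^k + 1`). Level 0 is `0/1, 1/1`; odd orders at level `k+1` are carried
over from level `k`, even orders are mediants. -/
def fareyNum : ℕ → ℕ → ℕ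
  | 0, n => if n = 1 then 0 else 1
  | k + 1, m =>
      if m % 2 = 1 then fareyNum k ((m + 1) / 2)
      else fareyNum k (m / 2) + fareyNum k (m / 2 + 1)

/-- Denominators of the modified Farey sequence. -/
def fareyDen : ℕ → ℕ → ℕ
  | 0, _ => 1
  | k + 1, m =>
      if m % 2 = 1 then fareyDen k ((m + 1) / 2)
      else fareyDen k (m / 2) + fareyDen k (m / 2 + 1)

/-- The Farey fraction `r_k^(n) = n_k^(n) / d_k^(n)` as a real number. -/
noncomputable def fareyR (k n : ℕ) : ℝ := (fareyNum k n : ℝ) / (fareyDen k n : ℝ)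

/-- The interval `I_k^(n)`: for `n ≥ 2` it is `r_k^(2n) - r_k^(2n-2)`, and
`I_k^(1) := 2/(k+1)`. -/
noncomputable def fareyI (k n : ℕ) : ℝ :=
  if n = 1 then 2 / ((k : ℝ) + 1) else fareyR k (2 * n) - fareyR k (2 * n - 2)

/-- Total length of even intervals at level `k`. -/
noncomputable def fareyIe (k : ℕ) : ℝ :=
  ∑ i ∈ Finset.Icc 1 (2 ^ (k - 2)), fareyI k (2 * i)

/-- Total length of odd intervals at level `k`. -/
noncomputable def fareyIo (k : ℕ) : ℝ :=
  ∑ i ∈ Finset.Icc 1 (2 ^ (k - 2)), fareyI k (2 * i - 1)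

/-- `S_k`: the sum of inverse squares of the new denominators at level `k`. -/
noncomputable def fareyS (k : ℕ) : ℝ :=
  ∑ n ∈ Finset.Icc 1 (2 ^ (k - 1)), 1 / (fareyDen k (2 * n) : ℝ) ^ 2

theorem fareyNum_succ_odd (k i : ℕ) : fareyNum (k + 1) (2 * i + 1) = fareyNum k (i + 1) := by
  rw [fareyNum, if_pos (by omega)]
  congr 1
  omega

theorem fareyNum_succ_even (k i : ℕ) :
    fareyNum (k + 1) (2 * i) = fareyNum k i + fareyNum k (i + 1) := by
  rw [fareyNum, if_neg (by omega), Nat.mul_div_cancel_left i two_pos]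

theorem fareyDen_succ_odd (k i : ℕ) : fareyDen (k + 1) (2 * i + 1) = fareyDen k (i + 1) := by
  rw [fareyDen, if_pos (by omega)]
  congr 1
  omega

theorem fareyDen_succ_even (k i : ℕ) :
    fareyDen (k + 1) (2 * i) = fareyDen k i + fareyDen k (i + 1) := by
  rw [fareyDen, if_neg (by omega), Nat.mul_div_cancel_left i two_pos]

theorem fareyDen_pos (k n : ℕ) : 0 < fareyDen k n := by
  induction k generalizing n with
  | zero => simp [fareyDen]
  | succ k ih =>
    rw [fareyDen]
    split_ifs
    · exact ih _
    · exact Nat.add_pos_left (ih _) _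

/-- Consecutive Farey fractions are unimodular. -/
theorem fareyNum_mul_fareyDen (k n : ℕ) (h1 : 1 ≤ n) (h2 : n ≤ 2 ^ k) :
    fareyNum k (n + 1) * fareyDen k n = fareyNum k n * fareyDen k (n + 1) + 1 := by
  induction k generalizing n with
  | zero =>
    obtain rfl : n = 1 := by simp at h2; omega
    simp [fareyNum, fareyDen]
  | succ k ih =>
    rw [pow_succ] at h2
    obtain ⟨i, rfl | rfl⟩ := n.even_or_odd'
    · have := ih i (by omega) (by omega)
      simp only [fareyNum_succ_odd, fareyNum_succ_even, fareyDen_succ_odd, fareyDen_succ_even]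
      linarith
    · have := ih (i + 1) (by omega) (by omega)
      rw [show 2 * i + 1 + 1 = 2 * (i + 1) by ring]
      simp only [fareyNum_succ_odd, fareyNum_succ_even, fareyDen_succ_odd, fareyDen_succ_even]
      linarith

/-- After `t` refinements, the fraction of order `p + 1` sits at order `2 ^ t * p + 1`, and its
neighbours are obtained by taking the mediant with it `t` times. The statement holds for any
array `f` obeying the mediant recursion. -/
theorem mediant_neighbours (f : ℕ → ℕ → ℕ)
    (hodd : ∀ k i, f (k + 1) (2 * i + 1) = f k (i + 1))
    (heven : ∀ k i, f (k + 1) (2 * i) = f k i + f k (i + 1)) (k p t : ℕ) :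
    f (k + t) (2 ^ t * p) = f k p + t * f k (p + 1) ∧
      f (k + t) (2 ^ t * p + 1) = f k (p + 1) ∧
      f (k + t) (2 ^ t * p + 2) = f k (p + 2) + t * f k (p + 1) := by
  induction t with
  | zero => simp
  | succ t ih =>
    obtain ⟨hl, hc, hr⟩ := ih
    rw [← add_assoc, show 2 ^ (t + 1) * p = 2 * (2 ^ t * p) by ring]
    refine ⟨?_, ?_, ?_⟩
    · rw [heven, hl, hc]; ring
    · rw [hodd, hc]
    · rw [show 2 * (2 ^ t * p) + 2 = 2 * (2 ^ t * p + 1) by ring, heven, hc, hr]; ring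

/-- The neighbours of the mediant of orders `n` and `n + 1` at level `k`, seen `t` levels after the
mediant appears. -/
theorem mediant_neighbours_of_new (f : ℕ → ℕ → ℕ)
    (hodd : ∀ k i, f (k + 1) (2 * i + 1) = f k (i + 1))
    (heven : ∀ k i, f (k + 1) (2 * i) = f k i + f k (i + 1)) (k n t : ℕ) (hn : 1 ≤ n) :
    f (k + 1 + t) (2 ^ t * (2 * n - 1)) = (t + 1) * f k n + t * f k (n + 1) ∧
      f (k + 1 + t) (2 ^ t * (2 * n - 1) + 2) = t * f k n + (t + 1) * f k (n + 1) := by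
  obtain ⟨i, rfl⟩ := Nat.exists_eq_add_of_le' hn
  obtain ⟨hl, -, hr⟩ := mediant_neighbours f hodd heven (k + 1) (2 * i + 1) t
  rw [show 2 * (i + 1) - 1 = 2 * i + 1 by omega, hl, hr,
    show 2 * i + 1 + 1 = 2 * (i + 1) by ring, show 2 * i + 1 + 2 = 2 * (i + 1) + 1 by ring,
    hodd, hodd, heven]
  constructor <;> ring

/-- The length of the interval around a mediant, `t` levels after the mediant appears. -/
theorem fareyR_sub_fareyR (k n t : ℕ) (h1 : 1 ≤ n) (h2 : n ≤ 2 ^ k) :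
    fareyR (k + 1 + t) (2 ^ t * (2 * n - 1) + 2) - fareyR (k + 1 + t) (2 ^ t * (2 * n - 1)) =
      (2 * (t : ℝ) + 1) /
        ((t * fareyDen k n + (t + 1) * fareyDen k (n + 1)) *
          ((t + 1) * fareyDen k n + t * fareyDen k (n + 1))) := by
  obtain ⟨hnl, hnr⟩ :=
    mediant_neighbours_of_new fareyNum fareyNum_succ_odd fareyNum_succ_even k n t h1
  obtain ⟨hdl, hdr⟩ :=
    mediant_neighbours_of_new fareyDen fareyDen_succ_odd fareyDen_succ_even k n t h1
  have hdet : (fareyNum k (n + 1) : ℝ) * fareyDen k n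
      = fareyNum k n * fareyDen k (n + 1) + 1 := mod_cast fareyNum_mul_fareyDen k n h1 h2
  have hb : (0 : ℝ) < fareyDen k n := mod_cast fareyDen_pos k n
  have hd : (0 : ℝ) < fareyDen k (n + 1) := mod_cast fareyDen_pos k (n + 1)
  simp only [fareyR, hnl, hnr, hdl, hdr]
  push_cast
  rw [div_sub_div _ _ (by positivity) (by positivity)]
  congr 1
  linear_combination (2 * (t : ℝ) + 1) * hdet

/-- Ratio of the `j`-th descendant odd interval to its parent even interval,
where `z = d_{m-2}^(n) / d_{m-2}^(n+1)`. -/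
theorem farey_interval_ratio (m j n : ℕ) (hm : 2 ≤ m) (hj : 1 ≤ j)
    (h1 : 1 ≤ n) (h2 : n ≤ 2 ^ (m - 2)) (z : ℝ)
    (hz : z = (fareyDen (m - 2) n : ℝ) / (fareyDen (m - 2) (n + 1) : ℝ)) :
    fareyI (m + j) (2 ^ j * (2 * n - 1) + 1) / fareyI m (2 * n) =
      ((2 * (j : ℝ) + 3) / 3) * ((1 + 2 * z) * (2 + z)) /
        ((((j : ℝ) + 1) + ((j : ℝ) + 2) * z) * (((j : ℝ) + 2) + ((j : ℝ) + 1) * z)) := by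
  obtain ⟨k, rfl⟩ := Nat.exists_eq_add_of_le' hm
  rw [Nat.add_sub_cancel] at h2 hz
  have hparent := fareyR_sub_fareyR k n 1 h1 h2
  have hchild := fareyR_sub_fareyR k n (j + 1) h1 h2
  have hpos : 0 < 2 ^ j * (2 * n - 1) := Nat.mul_pos (by positivity) (by omega)
  rw [fareyI, fareyI, if_neg (by omega), if_neg (by omega),
    show 2 * (2 * n) - 2 = 2 ^ 1 * (2 * n - 1) by omega,
    show 2 * (2 * n) = 2 ^ 1 * (2 * n - 1) + 2 by omega,
    show 2 * (2 ^ j * (2 * n - 1) + 1) - 2 = 2 ^ (j + 1) * (2 * n - 1) by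
      rw [mul_add, mul_one, Nat.add_sub_cancel]; ring,
    show 2 * (2 ^ j * (2 * n - 1) + 1) = 2 ^ (j + 1) * (2 * n - 1) + 2 by ring,
    show k + 2 + j = k + 1 + (j + 1) by ring, show k + 2 = k + 1 + 1 by ring, hparent, hchild, hz]
  have hb : (0 : ℝ) < fareyDen k n := mod_cast fareyDen_pos k n
  have hd : (0 : ℝ) < fareyDen k (n + 1) := mod_cast fareyDen_pos k (n + 1)
  push_cast
  field_simp
  ring
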